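/- If G is a connected graph with maximum degree Δ(G) = 3, then pd(G) ≤ 2. -/

import Mathlib

open SimpleGraph

variable {V : Type*}

/-- Two edges are adjacent: distinct and sharing an endpoint. -/
def EdgesAdj (e₁ e₂ : Sym2 V) : Prop := e₁ ≠ e₂ ∧ ∃ v, v ∈ e₁ ∧ v ∈ e₂

/-- `F` is an edge-cut of `G` separating `x` and `y`. -/
def IsSepCut (G : SimpleGraph V) (F : Set (Sym2 V)) (x y : V) : Prop :=
  F ⊆ G.edgeSet ∧ ¬ (G.deleteEdges F).Reachable x y

/-- `F` is a proper edge-cut (w.r.t. edge-coloring `c`) separating `x` and `y`. -/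
def IsProperSepCut (G : SimpleGraph V) (c : Sym2 V → ℕ) (F : Set (Sym2 V)) (x y : V) : Prop :=
  IsSepCut G F x y ∧ ∀ e₁ ∈ F, ∀ e₂ ∈ F, EdgesAdj e₁ e₂ → c e₁ ≠ c e₂

/-- `F` is a rainbow edge-cut separating `x` and `y`. -/
def IsRainbowSepCut (G : SimpleGraph V) (c : Sym2 V → ℕ) (F : Set (Sym2 V)) (x y : V) : Prop :=
  IsSepCut G F x y ∧ Set.InjOn c F

/-- `F` is a matching cut separating `x` and `y`. -/
def IsMatchingSepCut (G : SimpleGraph V) (F : Set (Sym2 V)) (x y : V) : Prop :=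
  IsSepCut G F x y ∧ ∀ e₁ ∈ F, ∀ e₂ ∈ F, ¬ EdgesAdj e₁ e₂

/-- The proper disconnection number. -/
noncomputable def pd (G : SimpleGraph V) : ℕ :=
  sInf {k | ∃ c : Sym2 V → ℕ, (∀ e ∈ G.edgeSet, c e < k) ∧
    ∀ x y : V, x ≠ y → ∃ F, IsProperSepCut G c F x y}

/-- The rainbow disconnection number. -/
noncomputable def rd (G : SimpleGraph V) : ℕ :=
  sInf {k | ∃ c : Sym2 V → ℕ, (∀ e ∈ G.edgeSet, c e < k) ∧
    ∀ x y : V, x ≠ y → ∃ F, IsRainbowSepCut G c F x y}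

/-- The chromatic index. -/
noncomputable def chromIndex (G : SimpleGraph V) : ℕ :=
  sInf {k | ∃ c : Sym2 V → ℕ, (∀ e ∈ G.edgeSet, c e < k) ∧
    ∀ e₁ ∈ G.edgeSet, ∀ e₂ ∈ G.edgeSet, EdgesAdj e₁ e₂ → c e₁ ≠ c e₂}


def Deg2 (H : SimpleGraph V) : Prop :=
  ∀ v a b c, H.Adj v a → H.Adj v b → H.Adj v c → a = b ∨ b = c ∨ a = c

def Mat (M : SimpleGraph V) : Prop := ∀ v a b, M.Adj v a → M.Adj v b → a = b

def Tri (H : SimpleGraph V) (a b c : V) : Prop := H.Adj a b ∧ H.Adj b c ∧ H.Adj a c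

def Cross (S : Set V) (a b : V) : Prop := (a ∈ S ∧ b ∉ S) ∨ (a ∉ S ∧ b ∈ S)

def SepOK (G : SimpleGraph V) (c : Sym2 V → ℕ) : Prop :=
  ∀ x y, x ≠ y → ∃ S : Set V, Cross S x y ∧ ∀ v a b, G.Adj v a → G.Adj v b → a ≠ b →
    Cross S v a → Cross S v b → c s(v, a) ≠ c s(v, b)

theorem tri_closed {H : SimpleGraph V} (h2 : Deg2 H) {a b c d : V} (t : Tri H a b c)
    (h : H.Adj a d) : d = b ∨ d = c := by
  have := h2 a b c d t.1 t.2.2 h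
  have := t.2.1.ne
  grind

theorem Tri.r {H : SimpleGraph V} {a b c : V} (t : Tri H a b c) : Tri H b c a :=
  ⟨t.2.1, t.2.2.symm, t.1.symm⟩

theorem Tri.s {H : SimpleGraph V} {a b c : V} (t : Tri H a b c) : Tri H b a c :=
  ⟨t.1.symm, t.2.2, t.2.1⟩

theorem tri_unique {H : SimpleGraph V} (h2 : Deg2 H) {a b c d e : V} (t : Tri H a b c)
    (t' : Tri H a d e) : (d = b ∧ e = c) ∨ (d = c ∧ e = b) := by
  have h1 := tri_closed h2 t t'.1
  have h3 := tri_closed h2 t t'.2.2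
  have := t'.2.1.ne
  grind

/-- local cut in a graph of maximum degree two -/
theorem local_cut {H : SimpleGraph V} (h2 : Deg2 H) (x y : V) (hxy : x ≠ y)
    (hn : ∀ z, ¬ Tri H x y z) :
    ∃ P : Set V, x ∈ P ∧ y ∉ P ∧ ∀ v a b, H.Adj v a → H.Adj v b → Cross P v a →
      Cross P v b → a = b := by
  by_cases h : ∃ w, H.Adj x w ∧ w ≠ y
  · obtain ⟨w, hw, hwy⟩ := h
    by_cases ht : ∃ z, Tri H x w z
    · obtain ⟨z, t⟩ := ht
      have hzy : z ≠ y := by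
        rintro rfl
        exact hn w t.r.r.s
      refine ⟨{x, w, z}, by simp, by simp; grind, ?_⟩
      have c1 := fun d => tri_closed h2 t (d := d)
      have c2 := fun d => tri_closed h2 t.r (d := d)
      have c3 := fun d => tri_closed h2 t.r.r (d := d)
      have key : ∀ v a, H.Adj v a → ¬ Cross {x, w, z} v a := by
        intro v a hva hc
        have := hva.symm
        simp only [Cross, Set.mem_insert_iff, Set.mem_singleton_iff] at hc
        grind
      intro v a b hva _ hc
      exact absurd hc (key v a hva)
    · refine ⟨{x, w}, by simp, by simp; grind, ?_⟩
      intro v a b ha hb hca hcb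
      simp only [Cross, Set.mem_insert_iff, Set.mem_singleton_iff] at hca hcb
      have h2x := h2 x w
      have h2w := h2 w x
      have hs := H.symm
      have hws := hw.symm
      have has := ha.symm
      have hbs := hb.symm
      simp only [Tri, not_exists] at ht
      grind
  · refine ⟨{x}, by simp, by simp; grind, ?_⟩
    intro v a b ha hb hca hcb
    simp only [Cross, Set.mem_singleton_iff] at hca hcb
    grind

theorem exists_key [Finite V] (M : SimpleGraph V) (hm : Mat M) :
    ∃ (N : ℕ) (k : V → ℕ), (∀ v, k v < N) ∧ (∀ a b, M.Adj a b → k a = k b) ∧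
      ∀ a b, k a = k b → a = b ∨ M.Adj a b := by
  classical
  obtain ⟨n, ⟨e⟩⟩ := Finite.exists_equiv_fin V
  let mt : V → V := fun v => if h : ∃ w, M.Adj v w then h.choose else v
  have mt1 : ∀ v w, M.Adj v w → mt v = w := by
    intro v w h
    have h' : ∃ w, M.Adj v w := ⟨w, h⟩
    simp only [mt, dif_pos h']
    exact hm v _ _ h'.choose_spec h
  have mt2 : ∀ v, mt v = v ∨ M.Adj v (mt v) := by
    intro v
    by_cases h' : ∃ w, M.Adj v w
    · right
      simp only [mt, dif_pos h']
      exact h'.choose_spec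
    · left
      simp only [mt, dif_neg h']
  have einj : ∀ a b, (e a : ℕ) = e b → a = b := fun a b h => e.injective (Fin.ext h)
  refine ⟨n, fun v => min (e v : ℕ) (e (mt v)), ?_, ?_, ?_⟩
  · intro v
    have := (e v).2
    simp only
    omega
  · intro a b h
    have h1 := mt1 a b h
    have h3 := mt1 b a h.symm
    simp only [h1, h3]
    omega
  · intro a b h
    simp only at h
    have : a = b ∨ a = mt b ∨ mt a = b ∨ mt a = mt b := by
      rcases min_choice (e a : ℕ) (e (mt a)) with h1 | h1 <;>
      rcases min_choice (e b : ℕ) (e (mt b)) with h3 | h3 <;>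
      rw [h1, h3] at h <;> have := einj _ _ h <;> tauto
    rcases mt2 a with h1 | h1 <;> rcases mt2 b with h3 | h3
    · grind
    · rw [h1] at this
      have := h3.symm
      grind
    · rw [h3] at this
      grind
    · have h4 := h3.symm
      rcases this with h | h | h | h
      · exact .inl h
      · right; rw [h]; exact h4
      · right; rw [← h]; exact h1
      · left; rw [h] at h1; exact hm _ _ _ h1.symm h4

def Bad (H M : SimpleGraph V) (c : V) : Prop :=
  ∃ a b a' b' d, Tri H a b c ∧ M.Adj a a' ∧ M.Adj b b' ∧ Tri H a' b' d ∧ ¬ M.Adj c d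

theorem bad_norm {H M : SimpleGraph V} (h2 : Deg2 H) {a b c : V}
    (t : Tri H a b c) (h : Bad H M a) :
    ∃ b' c' d, M.Adj b b' ∧ M.Adj c c' ∧ Tri H b' c' d ∧ ¬ M.Adj a d := by
  obtain ⟨a1, b1, a1', b1', d1, t1, h1, h1', t1', n1⟩ := h
  rcases tri_unique h2 t t1.r.r with ⟨rfl, rfl⟩ | ⟨rfl, rfl⟩
  · exact ⟨_, _, _, h1, h1', t1', n1⟩
  · exact ⟨_, _, _, h1', h1, t1'.s, n1⟩

theorem bad_two {H M : SimpleGraph V} (h2 : Deg2 H) (hm : Mat M) {a b c : V}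
    (t : Tri H a b c) (ha : Bad H M a) (hb : Bad H M b) : False := by
  obtain ⟨b', c', d, h1, h3, t1, n1⟩ := bad_norm h2 t ha
  obtain ⟨c1, a', e, h5, h6, t3, n3⟩ := bad_norm h2 t.r hb
  obtain rfl := hm _ _ _ h3 h5
  rcases tri_unique h2 t1.r t3 with ⟨rfl, rfl⟩ | ⟨rfl, rfl⟩
  · exact n1 h6
  · exact t.1.ne (hm _ _ _ h6.symm h1.symm)

theorem exists_rank [Finite V] (H M : SimpleGraph V) (h2 : Deg2 H) (hm : Mat M)
    (hd : ∀ a b, H.Adj a b → ¬ M.Adj a b) :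
    ∃ r : V → ℕ, (∀ a b c, Tri H a b c → r a ≠ r b) ∧
      ∀ a b c a' b' d, Tri H a b c → r c < r a → r c < r b → M.Adj a a' → M.Adj b b' →
        Tri H a' b' d → M.Adj c d ∧ r d < r a' ∧ r d < r b' := by
  classical
  obtain ⟨N, k, hkN, hk1, hk2⟩ := exists_key M hm
  let bad : V → Prop := Bad H M
  have nb : ∀ a b c, Tri H a b c → bad a → bad b → False := fun a b c t => bad_two h2 hm t
  have nb' : ∀ a b c a' b' d, Tri H a b c → M.Adj a a' → M.Adj b b' → M.Adj c d →
      Tri H a' b' d → ¬ bad c := by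
    intro a b c a' b' d t ha hb hc t' hbad
    obtain ⟨a1, b1, d1, h1, h3, t1, n1⟩ := bad_norm h2 t.r.r hbad
    obtain rfl := hm _ _ _ ha h1
    obtain rfl := hm _ _ _ hb h3
    have := tri_unique h2 t' t1
    have := t1.2.1.ne
    grind
  let r : V → ℕ := fun v => if bad v then k v + N else k v
  have hkd : ∀ a b, H.Adj a b → k a ≠ k b := by
    intro a b h he
    rcases hk2 a b he with h1 | h1
    · exact h.ne h1
    · exact hd a b h h1
  refine ⟨r, ?_, ?_⟩
  · intro a b c t he
    have := hkN a
    have := hkN b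
    have := hkd a b t.1
    simp only [r] at he
    split_ifs at he <;> omega
  · intro a b c a' b' d t r1 r3 ha hb t'
    have gc : ¬ bad c := by
      intro hc
      have h1 : ¬ bad a := fun h => nb a c b t.r.r.s h hc
      have := hkN a
      simp only [r, if_pos hc, if_neg h1] at r1
      omega
    have hcd : M.Adj c d := by
      by_contra hn
      exact gc ⟨a, b, a', b', d, t, ha, hb, t', hn⟩
    have gd := nb' a' b' d a b c t' ha.symm hb.symm hcd.symm t
    have ga := nb' b c a b' d a' t.r hb hcd ha t'.r
    have gb := nb' c a b d a' b' t.r.r hcd ha hb t'.r.r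
    have ga' := nb' b' d a' b c a t'.r hb.symm hcd.symm ha.symm t.r
    have gb' := nb' d a' b' c a b t'.r.r hcd.symm ha.symm hb.symm t.r.r
    have := hk1 _ _ ha
    have := hk1 _ _ hb
    have := hk1 _ _ hcd
    refine ⟨hcd, ?_, ?_⟩
    · simp only [r, if_neg gc, if_neg ga] at r1
      simp only [r, if_neg gd, if_neg ga']
      omega
    · simp only [r, if_neg gc, if_neg gb] at r3
      simp only [r, if_neg gd, if_neg gb']
      omega

def Sp (H : SimpleGraph V) (r : V → ℕ) (u v : V) : Prop :=
  ∃ w, Tri H u v w ∧ r w < r u ∧ r w < r v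

theorem Sp.symm {H : SimpleGraph V} {r : V → ℕ} {u v : V} (h : Sp H r u v) : Sp H r v u := by
  obtain ⟨w, t, h1, h2⟩ := h
  exact ⟨w, t.s, h2, h1⟩

/-- combinatorial properness of a cut -/
def Prp (H M : SimpleGraph V) (r : V → ℕ) (S : Set V) : Prop :=
  (∀ v a b, H.Adj v a → H.Adj v b → a ≠ b → Cross S v a → Cross S v b →
    (Sp H r v a ↔ ¬ Sp H r v b)) ∧
  ∀ v a b, M.Adj v a → H.Adj v b → Cross S v a → Cross S v b → ¬ Sp H r v b

theorem no_tri_cross {H : SimpleGraph V} {P : Set V}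
    (hP : ∀ v a b, H.Adj v a → H.Adj v b → Cross P v a → Cross P v b → a = b)
    {v b w : V} (t : Tri H v b w) : ¬ Cross P v b := by
  intro hc
  have h1 := hP v b w t.1 t.2.2 hc
  have h2 := hP b v w t.1.symm t.2.1
  have := t.2.1.ne
  have := t.2.2.ne
  unfold Cross at *
  by_cases hw : w ∈ P <;> by_cases hv : v ∈ P <;> by_cases hb : b ∈ P <;> simp_all

theorem local_prp {H M : SimpleGraph V} {r : V → ℕ} {P : Set V}
    (hP : ∀ v a b, H.Adj v a → H.Adj v b → Cross P v a → Cross P v b → a = b) :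
    Prp H M r P := by
  refine ⟨fun v a b ha hb hab hca hcb => absurd (hP v a b ha hb hca hcb) hab, ?_⟩
  rintro v a b - hb - hc ⟨w, t, -⟩
  exact no_tri_cross hP t hc

theorem sp_apex {H : SimpleGraph V} {r : V → ℕ} (h2 : Deg2 H) {a b c : V} (t : Tri H a b c)
    (ra : r c < r a) (rb : r c < r b) : Sp H r a b ∧ ¬ Sp H r a c ∧ ¬ Sp H r b c := by
  refine ⟨⟨c, t, ra, rb⟩, ?_, ?_⟩
  · rintro ⟨w, t', h1, h3⟩
    rcases tri_unique h2 t t' with ⟨rfl, rfl⟩ | ⟨-, rfl⟩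
    · omega
    · omega
  · rintro ⟨w, t', h1, h3⟩
    rcases tri_unique h2 t.r t' with ⟨-, rfl⟩ | ⟨rfl, rfl⟩
    · omega
    · omega

set_option maxHeartbeats 2000000 in
theorem tri_cut {H M : SimpleGraph V} {r : V → ℕ} (h2 : Deg2 H) (hm : Mat M)
    (hd : ∀ a b, H.Adj a b → ¬ M.Adj a b)
    (hr : ∀ a b c a' b' d, Tri H a b c → r c < r a → r c < r b → M.Adj a a' → M.Adj b b' →
        Tri H a' b' d → M.Adj c d ∧ r d < r a' ∧ r d < r b')
    {a b c : V} (t : Tri H a b c) (ra : r c < r a) (rb : r c < r b) :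
    ∃ S : Set V, a ∈ S ∧ b ∉ S ∧ c ∉ S ∧ Prp H M r S := by
  obtain ⟨s1, s2, s3⟩ := sp_apex h2 t ra rb
  have s1' := s1.symm
  have s2' : ¬ Sp H r c a := fun h => s2 h.symm
  have s3' : ¬ Sp H r c b := fun h => s3 h.symm
  have ab := t.1.ne
  have bc := t.2.1.ne
  have ac := t.2.2.ne
  have ca := fun d => tri_closed h2 t (d := d)
  have cb := fun d => tri_closed h2 t.r (d := d)
  have cc := fun d => tri_closed h2 t.r.r (d := d)
  have nab := hd _ _ t.1
  have nac := hd _ _ t.2.2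
  have nbc := hd _ _ t.2.1
  by_cases hA : ∃ a', M.Adj a a'
  swap
  · refine ⟨{a}, by simp, by simp; grind, by simp; grind, ?_, ?_⟩
    · intro v x y hx hy hxy hcx hcy
      simp only [Cross, Set.mem_singleton_iff] at hcx hcy
      have := hx.symm
      have := hy.symm
      grind
    · intro v x y hx hy hcx hcy
      simp only [Cross, Set.mem_singleton_iff] at hcx hcy
      have := hx.symm
      have := hy.symm
      grind
  obtain ⟨a', ha⟩ := hA
  have a'a : a' ≠ a := ha.ne'
  have a'b : a' ≠ b := by rintro rfl; exact nab ha
  have a'c : a' ≠ c := by rintro rfl; exact nac ha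
  -- main generic construction
  have gen : ∀ y, a' ≠ y → (∀ z, ¬ Tri H a' y z) → (∀ b', M.Adj b b' → b' = y) →
      ∃ S : Set V, a ∈ S ∧ b ∉ S ∧ c ∉ S ∧ Prp H M r S := by
    intro y hy ht hb
    obtain ⟨P, hxP, hyP, hP⟩ := local_cut h2 a' y hy ht
    have mS : ∀ v, v ∈ (P \ {a, b, c}) ∪ {a} ↔ v = a ∨ (v ∈ P ∧ v ≠ b ∧ v ≠ c) := by
      intro v
      simp only [Set.mem_union, Set.mem_sdiff, Set.mem_insert_iff, Set.mem_singleton_iff]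
      tauto
    generalize hS : (P \ {a, b, c}) ∪ {a} = S at mS
    have hSa : a ∈ S := (mS a).2 (.inl rfl)
    have hSb : b ∉ S := by rw [mS]; tauto
    have hSc : c ∉ S := by rw [mS]; tauto
    have hout : ∀ v x, H.Adj v x → v ≠ a → v ≠ b → v ≠ c → Cross S v x →
        (Cross P v x ∧ x ≠ a ∧ x ≠ b ∧ x ≠ c) := by
      intro v x hvx h1 h3 h4 hc
      have := hvx.symm
      have xa : x ≠ a := by rintro rfl; have := ca v; tauto
      have xb : x ≠ b := by rintro rfl; have := cb v; tauto
      have xc : x ≠ c := by rintro rfl; have := cc v; tauto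
      refine ⟨?_, xa, xb, xc⟩
      simp only [Cross, mS] at hc ⊢
      tauto
    have hbM : ∀ x, M.Adj b x → ¬ Cross S b x := by
      intro x hx hc
      have e := hb x hx
      have xa : x ≠ a := by rintro rfl; exact nab hx.symm
      simp only [Cross, mS] at hc
      rw [e] at hc xa
      tauto
    have haM : ∀ x, M.Adj a x → ¬ Cross S a x := by
      intro x hx hc
      obtain rfl := hm _ _ _ ha hx
      simp only [Cross, mS] at hc
      tauto
    have hbc : ¬ Cross S b c := by simp only [Cross]; tauto
    have hcb : ¬ Cross S c b := by simp only [Cross]; tauto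
    refine ⟨S, hSa, hSb, hSc, ?_, ?_⟩
    · intro v x y hx hy hxy hcx hcy
      by_cases va : v = a
      · subst va
        rcases ca x hx with rfl | rfl <;> rcases ca y hy with rfl | rfl <;> tauto
      by_cases vb : v = b
      · subst vb
        rcases cb x hx with rfl | rfl <;> rcases cb y hy with rfl | rfl <;> tauto
      by_cases vc : v = c
      · subst vc
        rcases cc x hx with rfl | rfl <;> rcases cc y hy with rfl | rfl <;> tauto
      exact absurd (hP v x y hx hy (hout v x hx va vb vc hcx).1 (hout v y hy va vb vc hcy).1) hxy
    · intro v x y hx hy hcx hcy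
      by_cases va : v = a
      · subst va
        exact absurd hcx (haM x hx)
      by_cases vb : v = b
      · subst vb
        exact absurd hcx (hbM x hx)
      by_cases vc : v = c
      · subst vc
        rcases cc y hy with rfl | rfl <;> tauto
      rintro ⟨w, tw, -⟩
      exact no_tri_cross hP tw (hout v y hy va vb vc hcy).1
  by_cases hB : ∃ b', M.Adj b b'
  swap
  · refine gen a a'a ?_ (fun b' h => absurd ⟨b', h⟩ hB)
    intro z tz
    exact hd _ _ tz.1 ha.symm
  obtain ⟨b', hb⟩ := hB
  have a'b' : a' ≠ b' := by
    rintro rfl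
    exact ab (hm _ _ _ ha.symm hb.symm)
  by_cases hT : ∃ d, Tri H a' b' d
  swap
  · exact gen b' a'b' (fun z h => hT ⟨z, h⟩) (fun x hx => hm _ _ _ hx hb)
  obtain ⟨d, t'⟩ := hT
  obtain ⟨hcd, r1, r3⟩ := hr a b c a' b' d t ra rb ha hb t'
  obtain ⟨q1, q2, q3⟩ := sp_apex h2 t' r1 r3
  have q1' := q1.symm
  have q2' : ¬ Sp H r d a' := fun h => q2 h.symm
  have q3' : ¬ Sp H r d b' := fun h => q3 h.symm
  have ca' := fun x => tri_closed h2 t' (d := x)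
  have ma := fun x (h : M.Adj a x) => hm _ _ _ ha h
  have ma' := fun x (h : M.Adj a' x) => hm _ _ _ ha.symm h
  have mb := fun x (h : M.Adj b x) => hm _ _ _ hb h
  have mb' := fun x (h : M.Adj b' x) => hm _ _ _ hb.symm h
  have mc := fun x (h : M.Adj c x) => hm _ _ _ hcd h
  have mc' := fun x (h : M.Adj d x) => hm _ _ _ hcd.symm h
  have e1 := t'.1.ne
  have e2 := t'.2.1.ne
  have e3 := t'.2.2.ne
  have b'a : b' ≠ a := by rintro rfl; exact nab hb.symm
  have da : d ≠ a := by rintro rfl; exact nac hcd.symm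
  have MN : ∀ v x, M.Adj v x → ¬ Cross {a, a'} v x := by
    intro v x h hc
    simp only [Cross, Set.mem_insert_iff, Set.mem_singleton_iff] at hc
    rcases hc with ⟨rfl | rfl, h1⟩ | ⟨h1, rfl | rfl⟩
    · exact h1 (.inr (ma x h).symm)
    · exact h1 (.inl (ma' x h).symm)
    · exact h1 (.inr (ma v h.symm).symm)
    · exact h1 (.inl (ma' v h.symm).symm)
  have bb : b ≠ b' := hb.ne
  have cd : c ≠ d := hcd.ne
  have bd : b ≠ d := by rintro rfl; exact nbc hcd.symm
  have cb' : c ≠ b' := by rintro rfl; exact nbc hb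
  refine ⟨{a, a'}, by simp, by simp; exact ⟨ab.symm, a'b.symm⟩, by simp; exact ⟨ac.symm, a'c.symm⟩, ?_, ?_⟩
  · intro v x y hx hy hxy hcx hcy
    by_cases va : v = a
    · subst va
      rcases ca x hx with rfl | rfl <;> rcases ca y hy with rfl | rfl <;> tauto
    by_cases va' : v = a'
    · subst va'
      rcases ca' x hx with rfl | rfl <;> rcases ca' y hy with rfl | rfl <;> tauto
    exfalso
    have hN : ∀ x, Cross {a, a'} v x → x = a ∨ x = a' := by
      intro x hc
      simp only [Cross, Set.mem_insert_iff, Set.mem_singleton_iff] at hc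
      tauto
    have fin : H.Adj v a → H.Adj v a' → False := by
      intro k1 k2
      rcases ca v k1.symm with rfl | rfl <;> rcases ca' v k2.symm with h | h
      · exact bb h
      · exact bd h
      · exact cb' h
      · exact cd h
    rcases hN x hcx with rfl | rfl <;> rcases hN y hcy with rfl | rfl
    · exact hxy rfl
    · exact fin hx hy
    · exact fin hy hx
    · exact hxy rfl
  · intro v x y hx hy hcx hcy
    exact absurd hcx (MN v x hx)

theorem color_of_HM [Finite V] (G H M : SimpleGraph V) (h2 : Deg2 H) (hm : Mat M)
    (hd : ∀ a b, H.Adj a b → ¬ M.Adj a b) (hG : ∀ a b, G.Adj a b → H.Adj a b ∨ M.Adj a b) :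
    ∃ c : Sym2 V → ℕ, (∀ e, c e < 2) ∧ SepOK G c := by
  classical
  obtain ⟨r, hr1, hr2⟩ := exists_rank H M h2 hm hd
  let c : Sym2 V → ℕ := fun e => if ∃ u v, e = s(u, v) ∧ (M.Adj u v ∨ Sp H r u v) then 1 else 0
  have hc : ∀ u v, c s(u, v) = if M.Adj u v ∨ Sp H r u v then 1 else 0 := by
    intro u v
    simp only [c]
    congr 1
    refine propext ⟨?_, fun h => ⟨u, v, rfl, h⟩⟩
    rintro ⟨x, y, he, h⟩
    rcases Sym2.eq_iff.1 he with ⟨rfl, rfl⟩ | ⟨rfl, rfl⟩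
    · exact h
    · exact h.imp (fun h => h.symm) (fun h => h.symm)
  have hprp : ∀ S, Prp H M r S → ∀ v a b, G.Adj v a → G.Adj v b → a ≠ b →
    Cross S v a → Cross S v b → c s(v, a) ≠ c s(v, b) := by
    rintro S ⟨p1, p2⟩ v a b ha hb hab hca hcb
    rw [hc, hc]
    rcases hG _ _ ha with ha | ha <;> rcases hG _ _ hb with hb | hb
    · have := p1 v a b ha hb hab hca hcb
      have n1 := hd _ _ ha
      have n2 := hd _ _ hb
      by_cases h : Sp H r v a <;> simp_all
    · have := p2 v b a hb ha hcb hca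
      have n1 := hd _ _ ha
      simp_all
    · have := p2 v a b ha hb hca hcb
      have n1 := hd _ _ hb
      simp_all
    · exact absurd (hm _ _ _ ha hb) hab
  refine ⟨c, ?_, ?_⟩
  · intro e
    simp only [c]
    split_ifs <;> omega
  · intro x y hxy
    by_cases hT : ∃ z, Tri H x y z
    swap
    · obtain ⟨P, hx, hy, hP⟩ := local_cut h2 x y hxy (fun z h => hT ⟨z, h⟩)
      exact ⟨P, .inl ⟨hx, hy⟩, hprp P (local_prp hP)⟩
    obtain ⟨z, t⟩ := hT
    have n1 := hr1 _ _ _ t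
    have n2 := hr1 _ _ _ t.r
    have n3 := hr1 _ _ _ t.r.r
    rcases (by omega : (r z < r x ∧ r z < r y) ∨ (r x < r y ∧ r x < r z) ∨ (r y < r x ∧ r y < r z))
      with ⟨h1, h3⟩ | ⟨h1, h3⟩ | ⟨h1, h3⟩
    · obtain ⟨S, a1, a2, a3, hS⟩ := tri_cut h2 hm hd hr2 t h1 h3
      exact ⟨S, .inl ⟨a1, a2⟩, hprp S hS⟩
    · obtain ⟨S, a1, a2, a3, hS⟩ := tri_cut h2 hm hd hr2 t.r h1 h3
      exact ⟨S, .inr ⟨a3, a1⟩, hprp S hS⟩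
    · obtain ⟨S, a1, a2, a3, hS⟩ := tri_cut h2 hm hd hr2 t.r.r.s h1 h3
      exact ⟨S, .inl ⟨a1, a3⟩, hprp S hS⟩

def Bridgeless (G : SimpleGraph V) : Prop :=
  ∀ (S : Set V) (u v : V), u ∈ S → v ∉ S → G.Adj u v →
    ∃ u' v', u' ∈ S ∧ v' ∉ S ∧ G.Adj u' v' ∧ ¬ (u' = u ∧ v' = v)

open Classical in
theorem three_le_cross [Fintype V] (G : SimpleGraph V) (hb : Bridgeless G) (K : Finset V)
    (hK : ∀ v ∈ K, G.degree v = 3) (hodd : Odd K.card) :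
    3 ≤ (Finset.univ.filter (fun p : V × V => p.1 ∈ K ∧ p.2 ∉ K ∧ G.Adj p.1 p.2)).card := by
  set E := Finset.univ.filter (fun p : V × V => p.1 ∈ K ∧ p.2 ∉ K ∧ G.Adj p.1 p.2) with hE
  set I := Finset.univ.filter (fun p : V × V => p.1 ∈ K ∧ p.2 ∈ K ∧ G.Adj p.1 p.2) with hI
  set A := Finset.univ.filter (fun p : V × V => p.1 ∈ K ∧ G.Adj p.1 p.2) with hA
  have hA' : A.card = K.card * 3 := by
    rw [Finset.card_eq_sum_card_fiberwise (f := Prod.fst) (t := K)]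
    · rw [Finset.sum_const_nat]
      intro v hv
      rw [← hK v hv, ← G.card_neighborFinset_eq_degree]
      have : A.filter (fun p => p.1 = v) = (G.neighborFinset v).image (fun w => (v, w)) := by
        ext ⟨a, b⟩
        simp only [hA, Finset.mem_filter, Finset.mem_univ, true_and, Finset.mem_image,
          mem_neighborFinset, Prod.mk.injEq]
        constructor
        · rintro ⟨⟨h1, h3⟩, rfl⟩
          exact ⟨b, h3, rfl, rfl⟩
        · rintro ⟨w, h, rfl, rfl⟩
          exact ⟨⟨hv, h⟩, rfl⟩
      rw [this, Finset.card_image_of_injective]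
      intro x y h
      simpa using h
    · intro p hp
      simp only [hA, Finset.coe_filter, Set.mem_ofPred_eq] at hp
      exact hp.2.1
  have hIE : I.card + E.card = A.card := by
    rw [← Finset.card_union_of_disjoint]
    · congr 1
      ext p
      simp only [hA, hI, hE, Finset.mem_union, Finset.mem_filter, Finset.mem_univ, true_and]
      tauto
    · rw [Finset.disjoint_left]
      intro p
      simp only [hI, hE, Finset.mem_filter, Finset.mem_univ, true_and]
      tauto
  have hIev : Even I.card := by
    rw [← ZMod.natCast_eq_zero_iff_even]
    have : ∑ p ∈ I, (1 : ZMod 2) = 0 := by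
      refine Finset.sum_involution (fun p _ => p.swap) ?_ ?_ ?_ ?_
      · intro p hp
        decide
      · intro p hp _ he
        simp only [hI, Finset.mem_filter] at hp
        have := congrArg Prod.fst he
        exact hp.2.2.2.ne this.symm
      · intro p hp
        simp only [hI, Finset.mem_filter, Finset.mem_univ, true_and] at hp ⊢
        exact ⟨hp.2.1, hp.1, hp.2.2.symm⟩
      · intro p hp
        simp
    simpa using this
  have hne : E.card ≠ 1 := by
    intro h
    obtain ⟨⟨u, v⟩, h⟩ := Finset.card_eq_one.1 h
    have hm : ∀ p : V × V, p ∈ E ↔ (p.1 ∈ K ∧ p.2 ∉ K ∧ G.Adj p.1 p.2) := by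
      intro p
      simp [hE]
    have h1 := (hm (u, v)).1 (by simp [h])
    obtain ⟨u', v', a1, a2, a3, a4⟩ := hb (K : Set V) u v (by simpa using h1.1)
      (by simpa using h1.2.1) h1.2.2
    have h3 := (hm (u', v')).2 ⟨by simpa using a1, by simpa using a2, a3⟩
    rw [h] at h3
    simp at h3
    exact a4 h3
  obtain ⟨i, hi⟩ := hIev
  obtain ⟨k, hk⟩ := hodd
  omega

open Classical in
theorem exists_matching {V : Type*} [Fintype V] (G : SimpleGraph V) (hdeg : ∀ v, G.degree v ≤ 3)
    (hb : Bridgeless G) :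
    ∃ M : SimpleGraph V, M ≤ G ∧ Mat M ∧ ∀ v, G.degree v = 3 → ∃ w, M.Adj v w := by
  let Low : V ⊕ V → Prop := Sum.elim (fun u => G.degree u < 3) (fun _ => True)
  let G1 : SimpleGraph (V ⊕ V) :=
    { Adj := fun p q => p ≠ q ∧ ((Low p ∧ Low q) ∨ ∃ u v, p = .inl u ∧ q = .inl v ∧ G.Adj u v)
      symm := ⟨by
        rintro p q ⟨h1, h⟩
        refine ⟨h1.symm, ?_⟩
        rcases h with h | ⟨u, v, h3, h4, h5⟩
        · exact .inl h.symm
        · exact .inr ⟨v, u, h4, h3, h5.symm⟩⟩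
      loopless := ⟨fun p h => h.1 rfl⟩ }
  have adj_nl : ∀ u q, G.degree u = 3 → G1.Adj (.inl u) q → ∃ v, q = .inl v ∧ G.Adj u v := by
    rintro u q hu ⟨-, ⟨h, -⟩ | ⟨a, b, h1, h3, h4⟩⟩
    · simp only [Low, Sum.elim_inl] at h
      omega
    · cases h1
      exact ⟨b, h3, h4⟩
  have adj_in : ∀ u v, G.Adj u v → G1.Adj (.inl u) (.inl v) := by
    intro u v h
    refine ⟨?_, .inr ⟨u, v, rfl, rfl, h⟩⟩
    intro e
    cases e
    exact h.ne rfl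
  suffices hT : ∀ U, ¬ G1.IsTutteViolator U by
    obtain ⟨M0, hM, hsp⟩ := SimpleGraph.tutte.2 hT
    refine ⟨{ Adj := fun u v => M0.Adj (.inl u) (.inl v) ∧ G.Adj u v
              symm := ⟨fun u v h => ⟨h.1.symm, h.2.symm⟩⟩
              loopless := ⟨fun u h => h.2.ne rfl⟩ }, fun u v h => h.2, ?_, ?_⟩
    · intro v a b ha hb
      have := (hM (hsp (.inl v))).unique ha.1 hb.1
      exact Sum.inl.inj this
    · intro v hv
      obtain ⟨q, hq, -⟩ := hM (hsp (.inl v))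
      obtain ⟨w, rfl, hw⟩ := adj_nl v q hv hq.adj_sub
      exact ⟨w, hq, hw⟩
  intro U hU
  unfold IsTutteViolator at hU
  set X := (⊤ : G1.Subgraph).deleteVerts U with hX
  have hXv : ∀ p, p ∈ X.verts ↔ p ∉ U := by
    intro p
    simp [hX]
  have hXadj : ∀ p q : X.verts, G1.Adj p q → X.coe.Adj p q := by
    intro p q h
    have h1 := (hXv p).1 p.2
    have h2 := (hXv q).1 q.2
    simp [hX, h1, h2, h]
  -- parity
  have hcard : Nat.card X.verts + U.ncard = 2 * Fintype.card V := by
    have h1 : X.verts = Uᶜ := by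
      ext p
      simp [hXv]
    rw [h1, Nat.card_coe_set_eq, add_comm, Set.ncard_add_ncard_compl, Nat.card_eq_fintype_card,
      Fintype.card_sum]
    ring
  have hpar := X.coe.odd_ncard_oddComponents
  have hU2 : U.ncard + 2 ≤ X.coe.oddComponents.ncard := by
    by_contra hcon
    have h1 : X.coe.oddComponents.ncard = U.ncard + 1 := by omega
    rw [h1] at hpar
    have : Odd (U.ncard + 1) ↔ ¬ Odd (Nat.card X.verts) := by
      rw [Nat.odd_iff, Nat.odd_iff]
      omega
    tauto
  let O : Finset X.coe.ConnectedComponent := X.coe.oddComponents.toFinset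
  have hO : O.card = X.coe.oddComponents.ncard := (Set.ncard_eq_toFinset_card' _).symm
  let HasLow : X.coe.ConnectedComponent → Prop := fun C => ∃ p ∈ C.supp, Low p
  have hlow1 : (O.filter HasLow).card ≤ 1 := by
    rw [Finset.card_le_one]
    intro C hC C' hC'
    obtain ⟨p, hp, lp⟩ := (Finset.mem_filter.1 hC).2
    obtain ⟨q, hq, lq⟩ := (Finset.mem_filter.1 hC').2
    rw [ConnectedComponent.mem_supp_iff] at hp hq
    rw [← hp, ← hq, ConnectedComponent.eq]
    by_cases hpq : p = q
    · rw [hpq]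
    · exact (hXadj p q ⟨fun h => hpq (Subtype.ext h), .inl ⟨lp, lq⟩⟩).reachable
  have hsplit := Finset.card_filter_add_card_filter_not (s := O) HasLow
  set O' := O.filter (fun C => ¬ HasLow C) with hO'
  let K : X.coe.ConnectedComponent → Finset V := fun C =>
    Finset.univ.filter (fun v => ∃ h : Sum.inl v ∈ X.verts,
      X.coe.connectedComponentMk ⟨.inl v, h⟩ = C)
  have hKm : ∀ C v, v ∈ K C ↔ ∃ h : Sum.inl v ∈ X.verts,
      X.coe.connectedComponentMk ⟨.inl v, h⟩ = C := by
    intro C v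
    simp [K]
  let E : X.coe.ConnectedComponent → Finset (V × V) := fun C =>
    Finset.univ.filter (fun p : V × V => p.1 ∈ K C ∧ p.2 ∉ K C ∧ G.Adj p.1 p.2)
  have hE3 : ∀ C ∈ O', 3 ≤ (E C).card := by
    intro C hC
    rw [hO', Finset.mem_filter] at hC
    obtain ⟨hC1, hC2⟩ := hC
    have hodd : Odd C.supp.ncard := by simpa [O] using hC1
    apply three_le_cross G hb (K C)
    · intro v hv
      obtain ⟨h, e⟩ := (hKm C v).1 hv
      by_contra hne
      apply hC2
      refine ⟨⟨.inl v, h⟩, e, ?_⟩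
      have := hdeg v
      simp only [Low, Sum.elim_inl]
      omega
    · have : C.supp.ncard = (K C).card := by
        have e1 : (Subtype.val '' C.supp) = ((K C).image Sum.inl : Finset (V ⊕ V)) := by
          ext p
          simp only [Set.mem_image, Finset.coe_image, Finset.mem_coe]
          constructor
          · rintro ⟨⟨p, hp⟩, hpC, rfl⟩
            rcases p with v | v
            · exact ⟨v, (hKm C v).2 ⟨hp, hpC⟩, rfl⟩
            · exact absurd ⟨_, hpC, trivial⟩ hC2
          · rintro ⟨v, hv, rfl⟩
            obtain ⟨h, e⟩ := (hKm C v).1 hv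
            exact ⟨⟨_, h⟩, e, rfl⟩
        rw [← Set.ncard_image_of_injective _ Subtype.val_injective, e1, Set.ncard_coe_finset,
          Finset.card_image_of_injective _ Sum.inl_injective]
      rwa [← this]
  let U0 : Finset V := Finset.univ.filter (fun v => Sum.inl v ∈ U)
  have hU0 : U0.card ≤ U.ncard := by
    rw [← Finset.card_image_of_injective U0 (Sum.inl_injective (β := V)), ← Set.ncard_coe_finset]
    apply Set.ncard_le_ncard _ (Set.toFinite _)
    intro p hp
    simp only [Finset.coe_image, Set.mem_image, Finset.mem_coe] at hp
    obtain ⟨v, hv, rfl⟩ := hp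
    simpa [U0] using hv
  let D : Finset (V × V) := U0.biUnion (fun q => (G.neighborFinset q).image (fun p => (p, q)))
  have hD : D.card ≤ U0.card * 3 := by
    apply Finset.card_biUnion_le_card_mul
    intro q _
    exact Finset.card_image_le.trans (by rw [G.card_neighborFinset_eq_degree]; exact hdeg q)
  have hED : O'.biUnion E ⊆ D := by
    intro ⟨p, q⟩ h
    obtain ⟨C, hC, h⟩ := Finset.mem_biUnion.1 h
    obtain ⟨h1, h3, h4⟩ : p ∈ K C ∧ q ∉ K C ∧ G.Adj p q := by simpa [E] using h
    have hq : Sum.inl q ∈ U := by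
      by_contra hq
      have hq' := (hXv _).2 hq
      obtain ⟨hp', e⟩ := (hKm C p).1 h1
      apply h3
      refine (hKm C q).2 ⟨hq', ?_⟩
      rw [← e, ConnectedComponent.eq]
      exact (hXadj ⟨_, hp'⟩ ⟨_, hq'⟩ (adj_in p q h4)).reachable.symm
    refine Finset.mem_biUnion.2 ⟨q, by simpa [U0] using hq, ?_⟩
    exact Finset.mem_image.2 ⟨p, by simpa using h4.symm, rfl⟩
  have hdisj : (O' : Set X.coe.ConnectedComponent).PairwiseDisjoint E := by
    intro C _ C' _ hne
    rw [Function.onFun, Finset.disjoint_left]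
    intro p h1 h3
    have h1 := (Finset.mem_filter.1 h1).2.1
    have h3 := (Finset.mem_filter.1 h3).2.1
    obtain ⟨_, e1⟩ := (hKm _ _).1 h1
    obtain ⟨_, e3⟩ := (hKm _ _).1 h3
    exact hne (e1.symm.trans e3)
  have hsum : O'.card * 3 ≤ (O'.biUnion E).card := by
    rw [Finset.card_biUnion hdisj]
    have := Finset.card_nsmul_le_sum O' (fun C => (E C).card) 3 hE3
    simpa using this
  have := Finset.card_le_card hED
  omega

theorem bridge_side {G : SimpleGraph V} {c : Sym2 V → ℕ} {S : Set V} {u v : V} (hv : v ∉ S)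
    (hu : u ∈ S) (hS : ∀ a b, a ∈ S → b ∉ S → G.Adj a b → a = u ∧ b = v)
    (hc : SepOK (G.deleteEdges {s(u, v)}) c) (x y : V) (hx : x ∈ S) (hy : y ∈ S) (hxy : x ≠ y) :
    ∃ S : Set V, Cross S x y ∧ ∀ v a b, G.Adj v a → G.Adj v b → a ≠ b →
    Cross S v a → Cross S v b → c s(v, a) ≠ c s(v, b) := by
  obtain ⟨P, hP, hpr⟩ := hc x y hxy
  have mP : ∀ w, w ∈ {w | (w ∈ S ∧ w ∈ P) ∨ (w ∉ S ∧ u ∈ P)} ↔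
      (w ∈ S ∧ w ∈ P) ∨ (w ∉ S ∧ u ∈ P) := fun w => Iff.rfl
  generalize {w | (w ∈ S ∧ w ∈ P) ∨ (w ∉ S ∧ u ∈ P)} = P' at mP
  have key : ∀ a b, G.Adj a b → Cross P' a b →
      (G.deleteEdges {s(u, v)}).Adj a b ∧ Cross P a b := by
    intro a b hab hcr
    have h1 := hS a b
    have h3 := fun p q => hS b a p q hab.symm
    simp only [Cross, mP] at hcr
    have haS : a ∈ S := by
      by_contra haS
      by_cases hbS : b ∈ S
      · obtain ⟨rfl, rfl⟩ := h3 hbS haS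
        tauto
      · tauto
    have hbS : b ∈ S := by
      by_contra hbS
      obtain ⟨rfl, rfl⟩ := h1 haS hbS hab
      tauto
    refine ⟨?_, ?_⟩
    · rw [deleteEdges_adj]
      refine ⟨hab, ?_⟩
      intro he
      rw [Set.mem_singleton_iff, Sym2.eq_iff] at he
      rcases he with ⟨rfl, rfl⟩ | ⟨rfl, rfl⟩
      · exact hv hbS
      · exact hv haS
    · simp only [Cross]
      tauto
  refine ⟨P', ?_, ?_⟩
  · simp only [Cross, mP] at hP ⊢
    tauto
  · intro w a b ha hb hab hca hcb
    obtain ⟨a1, a3⟩ := key w a ha hca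
    obtain ⟨b1, b3⟩ := key w b hb hcb
    exact hpr w a b a1 b1 hab a3 b3

open Classical in
theorem color_bridgeless {V : Type*} [Fintype V] (G : SimpleGraph V) (hdeg : ∀ v, G.degree v ≤ 3)
    (hb : Bridgeless G) : ∃ c : Sym2 V → ℕ, (∀ e, c e < 2) ∧ SepOK G c := by
  obtain ⟨M, hMG, hm, hcov⟩ := exists_matching G hdeg hb
  refine color_of_HM G (G \ M) M ?_ hm ?_ ?_
  · intro v a b c ha hb hc
    rw [sdiff_adj] at ha hb hc
    by_contra hcon
    push Not at hcon
    obtain ⟨h1, h3, h4⟩ := hcon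
    have hle : ({a, b, c} : Finset V) ⊆ G.neighborFinset v := by
      intro w hw
      simp only [Finset.mem_insert, Finset.mem_singleton] at hw
      rw [mem_neighborFinset]
      rcases hw with rfl | rfl | rfl
      · exact ha.1
      · exact hb.1
      · exact hc.1
    have hcard : ({a, b, c} : Finset V).card = 3 := Finset.card_eq_three.2 ⟨a, b, c, h1, h4, h3, rfl⟩
    have h5 := Finset.card_le_card hle
    rw [hcard, G.card_neighborFinset_eq_degree] at h5
    have hd3 : G.degree v = 3 := le_antisymm (hdeg v) h5
    obtain ⟨w, hw⟩ := hcov v hd3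
    have heq : ({a, b, c} : Finset V) = G.neighborFinset v := by
      apply Finset.eq_of_subset_of_card_le hle
      rw [hcard, G.card_neighborFinset_eq_degree, hd3]
    have hwm : w ∈ ({a, b, c} : Finset V) := by
      rw [heq, mem_neighborFinset]
      exact hMG hw
    simp only [Finset.mem_insert, Finset.mem_singleton] at hwm
    rcases hwm with rfl | rfl | rfl
    · exact ha.2 hw
    · exact hb.2 hw
    · exact hc.2 hw
  · intro a b h
    rw [sdiff_adj] at h
    exact h.2
  · intro a b h
    rw [sdiff_adj]
    tauto

open Classical in
theorem color_all {V : Type*} [Fintype V] (G : SimpleGraph V) (hdeg : ∀ v, G.degree v ≤ 3) :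
    ∃ c : Sym2 V → ℕ, (∀ e, c e < 2) ∧ SepOK G c := by
  induction G using WellFoundedLT.induction with
  | ind G ih =>
  by_cases hb : Bridgeless G
  · exact color_bridgeless G hdeg hb
  unfold Bridgeless at hb
  push Not at hb
  obtain ⟨S, u, v, hu, hv, huv, hS⟩ := hb
  have hle : G.deleteEdges {s(u, v)} ≤ G := deleteEdges_le _
  have hlt : G.deleteEdges {s(u, v)} < G := by
    refine lt_of_le_of_ne hle ?_
    intro h
    have : (G.deleteEdges {s(u, v)}).Adj u v := by rw [h]; exact huv
    rw [deleteEdges_adj] at this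
    exact this.2 rfl
  obtain ⟨c, hc2, hc⟩ := ih _ hlt (fun w => by
    refine le_trans ?_ (hdeg w)
    rw [← card_neighborFinset_eq_degree, ← card_neighborFinset_eq_degree]
    refine Finset.card_le_card fun z hz => ?_
    rw [mem_neighborFinset] at hz ⊢
    exact hle hz)
  refine ⟨c, hc2, ?_⟩
  intro x y hxy
  have hcS : ∀ a b, G.Adj a b → Cross S a b → (a = u ∧ b = v) ∨ (a = v ∧ b = u) := by
    rintro a b hab (⟨h1, h3⟩ | ⟨h1, h3⟩)
    · exact .inl (hS a b h1 h3 hab)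
    · exact .inr (hS b a h3 h1 hab.symm).symm
  by_cases hsep : Cross S x y
  · refine ⟨S, hsep, ?_⟩
    intro w a b ha hb hab hca hcb
    have h1 := hcS w a ha hca
    have h3 := hcS w b hb hcb
    have := huv.ne
    exfalso
    rcases h1 with ⟨rfl, rfl⟩ | ⟨rfl, rfl⟩ <;> rcases h3 with ⟨h, rfl⟩ | ⟨h, rfl⟩
    · exact hab rfl
    · exact this h
    · exact this h.symm
    · exact hab rfl
  by_cases hx : x ∈ S
  · have hy : y ∈ S := by
      by_contra hy
      exact hsep (.inl ⟨hx, hy⟩)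
    exact bridge_side hv hu hS hc x y hx hy hxy
  · have hy : y ∉ S := fun hy => hsep (.inr ⟨hx, hy⟩)
    refine bridge_side (S := Sᶜ) (u := v) (v := u) (by simpa using hu) (by simpa using hv) ?_
      (by rwa [Sym2.eq_swap]) x y hx hy hxy
    intro a b ha hb hab
    exact (hS b a (by simpa using hb) ha hab.symm).symm

theorem pd_le_of_sepOK (G : SimpleGraph V) (c : Sym2 V → ℕ) (h2 : ∀ e, c e < 2)
    (hc : SepOK G c) : pd G ≤ 2 := by
  apply Nat.sInf_le
  refine ⟨c, fun e _ => h2 e, ?_⟩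
  intro x y hxy
  obtain ⟨S, hS, hpr⟩ := hc x y hxy
  have csymm : ∀ a b, Cross S a b → Cross S b a := by
    intro a b h
    simp only [Cross] at h ⊢
    tauto
  refine ⟨{e | e ∈ G.edgeSet ∧ ∃ a b, e = s(a, b) ∧ Cross S a b}, ⟨fun e he => he.1, ?_⟩, ?_⟩
  · intro hr
    have : x ∈ S ↔ y ∈ S := by
      obtain ⟨p⟩ := hr
      clear hS hxy
      induction p with
      | nil => exact Iff.rfl
      | cons h p ih =>
        rw [← ih]
        rw [deleteEdges_adj] at h
        by_contra hn
        exact h.2 ⟨h.1, _, _, rfl, by simp only [Cross]; tauto⟩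
    simp only [Cross] at hS
    tauto
  · rintro e₁ ⟨he1, a1, b1, q1, r1⟩ e₂ ⟨he2, a2, b2, q2, r2⟩ ⟨hne, v, hv1, hv2⟩
    have form : ∀ e a b, e = s(a, b) → v ∈ e → Cross S a b → ∃ w, e = s(v, w) ∧ Cross S v w := by
      rintro e a b rfl hv h
      rcases Sym2.mem_iff.1 hv with rfl | rfl
      · exact ⟨b, rfl, h⟩
      · exact ⟨a, Sym2.eq_swap, csymm _ _ h⟩
    obtain ⟨a, rfl, ha⟩ := form e₁ a1 b1 q1 hv1 r1
    obtain ⟨b, rfl, hb⟩ := form e₂ a2 b2 q2 hv2 r2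
    exact hpr v a b he1 he2 (fun h => hne (by rw [h])) ha hb

theorem stmt9 {V : Type*} [Fintype V] (G : SimpleGraph V) [DecidableRel G.Adj]
    (hconn : G.Connected) (hdeg : G.maxDegree = 3) :
    pd G ≤ 2 := by
  classical
  obtain ⟨c, h2, hc⟩ := color_all G (fun v => by
    rw [← hdeg]
    convert G.degree_le_maxDegree v)
  exact pd_le_of_sepOK G c h2 hc
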